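/- Let k ≥ 0 be an integer, set N := 4k + 12 (so that q = e^{2πi/N} is a primitive 2(2k+6)-th root of unity), and let a, b, c be nonnegative integers such that a + b + c is even, a + b ≥ c, b + c ≥ a, a + c ≥ b, and a + b + c ≤ k. Put m := (a+b-c)/2, n := (b+c-a)/2, p := (a+c-b)/2, and define Θ(m,n,p) recursively by Θ(m,n,0) := [2(m+n)+4][m+n+3][m+n+1]/([4][3]) and Θ(m,n,p) := ( A_p + Σ_{i=1}^{p-1} A_i · ∏_{j=i+1}^{p} B_j ) · Θ(m,n,p-1), where all quantum integers are [s]_N := sin(2πs/N)/sin(2π/N), α_t := [2t][t+1][t-1]/([2t+2][t]^2), β_t := [t-1]/([t][2]), A_i := -[6][2]/[3] + α_{m+i} + α_{n+i} + ([6][2]/[3])(β_{n+i} + β_{m+i}) - [4][2] β_{n+i} β_{m+i}, and B_j := α_{n+j} α_{m+j}. Then Θ(m,n,p) ≠ 0. (This is the numerical content of the corollary that in Sp(4)_k the space Hom(V_{(a,0)} ⊗ V_{(b,0)} ⊗ V_{(c,0)}, ℂ) is one-dimensional for admissible triples of sufficiently small total weight.) -/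

import Mathlib

/-- Root-of-unity quantum integer `[s]_N = sin(2πs/N)/sin(2π/N)`, corresponding to
specializing the quantum integer at `q = e^{2πi/N}`. -/
noncomputable def qiN (N : ℝ) (s : ℤ) : ℝ :=
  Real.sin (2 * Real.pi * s / N) / Real.sin (2 * Real.pi / N)

/-- The coefficient `α_t = [2t][t+1][t-1]/([2t+2][t]^2)`. -/
noncomputable def alphaN (N : ℝ) (t : ℤ) : ℝ :=
  qiN N (2 * t) * qiN N (t + 1) * qiN N (t - 1) / (qiN N (2 * t + 2) * (qiN N t) ^ 2)

/-- The coefficient `β_t = [t-1]/([t][2])`. -/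
noncomputable def betaN (N : ℝ) (t : ℤ) : ℝ :=
  qiN N (t - 1) / (qiN N t * qiN N 2)

/-- The coefficient
`A_i = -[6][2]/[3] + α_{m+i} + α_{n+i} + ([6][2]/[3])(β_{n+i}+β_{m+i}) - [4][2]β_{n+i}β_{m+i}`. -/
noncomputable def coeffA (N : ℝ) (m n : ℕ) (i : ℕ) : ℝ :=
  -(qiN N 6 * qiN N 2) / qiN N 3 + alphaN N ((m : ℤ) + i) + alphaN N ((n : ℤ) + i)
    + (qiN N 6 * qiN N 2 / qiN N 3) * (betaN N ((n : ℤ) + i) + betaN N ((m : ℤ) + i))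
    - qiN N 4 * qiN N 2 * (betaN N ((n : ℤ) + i) * betaN N ((m : ℤ) + i))

/-- The coefficient `B_j = α_{n+j} α_{m+j}`. -/
noncomputable def coeffB (N : ℝ) (m n : ℕ) (j : ℕ) : ℝ :=
  alphaN N ((n : ℤ) + j) * alphaN N ((m : ℤ) + j)

/-- The recursively defined value `Θ(m,n,p)` of the theta net (up to sign). -/
noncomputable def Theta (N : ℝ) (m n : ℕ) : ℕ → ℝ
  | 0 => qiN N (2 * ((m : ℤ) + n) + 4) * qiN N ((m : ℤ) + n + 3) * qiN N ((m : ℤ) + n + 1)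
      / (qiN N 4 * qiN N 3)
  | p + 1 =>
      (coeffA N m n (p + 1) + ∑ i ∈ Finset.Icc 1 p,
          coeffA N m n i * ∏ j ∈ Finset.Icc (i + 1) (p + 1), coeffB N m n j)
        * Theta N m n p

open Real in
/-- With `x = sθ`, `y = tθ`, this factors the trigonometric form of the coefficient `A` after
clearing denominators. -/
theorem trig_coeffA_factor (θ x y : ℝ) (hx : sin x ≠ 0) (hy : sin y ≠ 0)
    (hcx : cos (x + θ) ≠ 0) (hcy : cos (y + θ) ≠ 0) :
    -(2 * cos (3 * θ) * (2 * cos θ)) + cos x * sin (x - θ) / (cos (x + θ) * sin x)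
      + cos y * sin (y - θ) / (cos (y + θ) * sin y)
      + 2 * cos (3 * θ) * (sin (y - θ) / sin y + sin (x - θ) / sin x)
      - 2 * cos (2 * θ) * (sin (y - θ) / sin y * (sin (x - θ) / sin x))
    = -(cos (2 * θ) * cos (x + y + θ) * (sin (x + y + 2 * θ) * sin θ)
        / (cos (x + θ) * cos (y + θ) * sin x * sin y)) := by
  have h := sin_sq_add_cos_sq θ
  have e1 : x + y + θ = (x + θ) + y := by ring
  have e2 : x + y + 2 * θ = (x + θ) + (y + θ) := by ring
  have c2 : cos (2 * θ) = cos θ ^ 2 - sin θ ^ 2 := cos_two_mul' θ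
  have c3 : cos (3 * θ) = cos θ ^ 3 - 3 * cos θ * sin θ ^ 2 := by
    rw [cos_three_mul]
    linear_combination (3 * cos θ) * h
  rw [e1, e2, cos_add (x + θ) y, sin_add (x + θ) (y + θ), c2, c3]
  rw [sin_sub, sin_sub, sin_add x, sin_add y]
  have hP := cos_add x θ
  have hQ := cos_add y θ
  generalize cos (x + θ) = P at *
  generalize cos (y + θ) = Q at *
  generalize sin θ = u at *
  generalize cos θ = v at *
  generalize sin x = a at *
  generalize cos x = b at *
  generalize sin y = c at *
  generalize cos y = d at *
  clear e1 e2 c2 c3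
  field_simp
  subst hP hQ
  linear_combination -((b * (v * a - u * b) * c * (d * v - c * u)
    + a * (b * v - a * u) * d * (v * c - u * d)) * (u ^ 2 + v ^ 2 + 1)) * h

theorem qiN_eq (k : ℕ) (s : ℤ) :
    qiN (4 * (k : ℝ) + 12) s
      = Real.sin (s * (Real.pi / (2 * k + 6))) / Real.sin (Real.pi / (2 * k + 6)) := by
  have h : (4 * (k : ℝ) + 12) = 2 * (2 * k + 6) := by ring
  have h0 : (2 * (k : ℝ) + 6) ≠ 0 := by positivity
  unfold qiN
  rw [h]
  congr 2 <;> field_simp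

theorem sin_mul_pos (k : ℕ) (s : ℤ) (h0 : 0 < s) (h1 : s < 2 * k + 6) :
    0 < Real.sin (s * (Real.pi / (2 * k + 6))) := by
  have hs : (0 : ℝ) < s := by exact_mod_cast h0
  have hs1 : (s : ℝ) < 2 * k + 6 := by exact_mod_cast h1
  apply Real.sin_pos_of_pos_of_lt_pi
  · have := Real.pi_pos
    positivity
  · rw [mul_div_assoc', div_lt_iff₀ (by positivity), mul_comm]
    exact mul_lt_mul_of_pos_left hs1 Real.pi_pos

theorem cos_mul_pos (k : ℕ) (s : ℤ) (h0 : 0 ≤ s) (h1 : s < k + 3) :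
    0 < Real.cos (s * (Real.pi / (2 * k + 6))) := by
  have hs : (0 : ℝ) ≤ s := by exact_mod_cast h0
  have hs1 : (s : ℝ) < k + 3 := by exact_mod_cast h1
  have hpi := Real.pi_pos
  apply Real.cos_pos_of_mem_Ioo
  constructor
  · have : 0 ≤ (s : ℝ) * (Real.pi / (2 * k + 6)) := by positivity
    linarith
  · rw [mul_div_assoc', div_lt_iff₀ (by positivity)]
    nlinarith

theorem sin_base_pos (k : ℕ) : 0 < Real.sin (Real.pi / (2 * (k : ℝ) + 6)) := by
  simpa using sin_mul_pos k 1 one_pos (by lia)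

theorem qiN_pos (k : ℕ) (s : ℤ) (h0 : 0 < s) (h1 : s < 2 * k + 6) :
    0 < qiN (4 * (k : ℝ) + 12) s := by
  rw [qiN_eq]
  exact div_pos (sin_mul_pos k s h0 h1) (sin_base_pos k)

theorem qiN_nonneg (k : ℕ) (s : ℤ) (h0 : 0 ≤ s) (h1 : s < 2 * k + 6) :
    0 ≤ qiN (4 * (k : ℝ) + 12) s := by
  rcases h0.eq_or_lt with rfl | h
  · simp [qiN]
  · exact (qiN_pos k s h h1).le

/-- Quantum duplication formula `[2s] = 2 cos(sθ) [s]`. -/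
theorem qiN_two_mul (k : ℕ) (s : ℤ) :
    qiN (4 * (k : ℝ) + 12) (2 * s)
      = 2 * Real.cos (s * (Real.pi / (2 * k + 6))) * qiN (4 * (k : ℝ) + 12) s := by
  rw [qiN_eq, qiN_eq]
  push_cast
  rw [mul_assoc (2 : ℝ), Real.sin_two_mul]
  ring

theorem alphaN_nonneg (k : ℕ) (t : ℤ) (h0 : 0 < t) (h1 : 2 * t ≤ k) :
    0 ≤ alphaN (4 * (k : ℝ) + 12) t := by
  unfold alphaN
  have h2 := qiN_nonneg k (2 * t) (by lia) (by lia)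
  have h3 := qiN_nonneg k (t + 1) (by lia) (by lia)
  have h4 := qiN_nonneg k (t - 1) (by lia) (by lia)
  have h5 := qiN_nonneg k (2 * t + 2) (by lia) (by lia)
  positivity

theorem alphaN_eq (k : ℕ) (t : ℤ) (h0 : 0 < t) (h1 : 2 * t ≤ k) :
    alphaN (4 * (k : ℝ) + 12) t
      = Real.cos (t * (Real.pi / (2 * k + 6)))
          * Real.sin (t * (Real.pi / (2 * k + 6)) - Real.pi / (2 * k + 6))
        / (Real.cos (t * (Real.pi / (2 * k + 6)) + Real.pi / (2 * k + 6))
          * Real.sin (t * (Real.pi / (2 * k + 6)))) := by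
  have hu := (sin_base_pos k).ne'
  have hs := (sin_mul_pos k t h0 (by lia)).ne'
  have hs1 := (sin_mul_pos k (t + 1) (by lia) (by lia)).ne'
  have hc1 := (cos_mul_pos k (t + 1) (by lia) (by lia)).ne'
  unfold alphaN
  rw [show 2 * t + 2 = 2 * (t + 1) by ring, qiN_two_mul, qiN_two_mul, qiN_eq, qiN_eq, qiN_eq]
  push_cast at *
  simp only [add_mul, sub_mul, one_mul] at *
  generalize Real.pi / (2 * (k : ℝ) + 6) = θ at *
  generalize (t : ℝ) * θ = x at *
  field_simp

theorem betaN_eq (k : ℕ) (t : ℤ) :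
    betaN (4 * (k : ℝ) + 12) t
      = Real.sin (t * (Real.pi / (2 * k + 6)) - Real.pi / (2 * k + 6))
        / Real.sin (t * (Real.pi / (2 * k + 6))) / qiN (4 * (k : ℝ) + 12) 2 := by
  have hu := (sin_base_pos k).ne'
  unfold betaN
  rw [← div_div, qiN_eq, qiN_eq, div_div_div_cancel_right₀ hu]
  push_cast
  simp only [sub_mul, one_mul]

/-- Each `A_i` is negative in the admissible range. -/
theorem coeffA_neg (k m n i : ℕ) (hi : 0 < i) (hm : 2 * (m + i) ≤ k) (hn : 2 * (n + i) ≤ k) :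
    coeffA (4 * (k : ℝ) + 12) m n i < 0 := by
  have hu := sin_base_pos k
  have h2 := qiN_pos k 2 (by lia) (by lia)
  have h3 := qiN_pos k 3 (by lia) (by lia)
  have e2 : qiN (4 * (k : ℝ) + 12) 2 = 2 * Real.cos (Real.pi / (2 * k + 6)) := by
    have h := qiN_two_mul k 1
    rw [qiN_eq k 1] at h
    simpa [hu.ne'] using h
  have e4 := qiN_two_mul k 2
  have e6 := qiN_two_mul k 3
  have c2 := cos_mul_pos k 2 (by lia) (by lia)
  have hx := sin_mul_pos k ((m : ℤ) + i) (by lia) (by lia)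
  have hy := sin_mul_pos k ((n : ℤ) + i) (by lia) (by lia)
  have hcx := cos_mul_pos k ((m : ℤ) + i + 1) (by lia) (by lia)
  have hcy := cos_mul_pos k ((n : ℤ) + i + 1) (by lia) (by lia)
  have hc := cos_mul_pos k (((m : ℤ) + i) + (n + i) + 1) (by lia) (by lia)
  have hs := sin_mul_pos k (((m : ℤ) + i) + (n + i) + 2) (by lia) (by lia)
  unfold coeffA
  rw [alphaN_eq k _ (by lia) (by lia), alphaN_eq k _ (by lia) (by lia), betaN_eq, betaN_eq,
    show (6 : ℤ) = 2 * 3 by norm_num, show (4 : ℤ) = 2 * 2 by norm_num, e6, e4]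
  generalize (m : ℤ) + i = s at *
  generalize (n : ℤ) + i = t at *
  generalize Real.pi / (2 * (k : ℝ) + 6) = θ at *
  push_cast at *
  rw [add_one_mul] at hcx hcy
  rw [show ((s : ℝ) + t + 1) * θ = s * θ + t * θ + θ by ring] at hc
  rw [show ((s : ℝ) + t + 2) * θ = s * θ + t * θ + 2 * θ by ring] at hs
  have key := trig_coeffA_factor θ (s * θ) (t * θ) hx.ne' hy.ne' hcx.ne' hcy.ne'
  have hneg : 0 < Real.cos (2 * θ) * Real.cos (s * θ + t * θ + θ)
      * (Real.sin (s * θ + t * θ + 2 * θ) * Real.sin θ)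
        / (Real.cos (s * θ + θ) * Real.cos (t * θ + θ) * Real.sin (s * θ) * Real.sin (t * θ)) := by
    positivity
  have hlt := neg_lt_zero.mpr hneg
  rw [← key] at hlt
  refine lt_of_eq_of_lt ?_ hlt
  rw [← e2]
  field_simp

theorem coeffB_nonneg (k m n j : ℕ) (hj : 0 < j) (hm : 2 * (m + j) ≤ k) (hn : 2 * (n + j) ≤ k) :
    0 ≤ coeffB (4 * (k : ℝ) + 12) m n j :=
  mul_nonneg (alphaN_nonneg k _ (by lia) (by lia)) (alphaN_nonneg k _ (by lia) (by lia))

theorem Theta_ne_zero (k m n : ℕ) :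
    ∀ p : ℕ, 2 * (m + n + p) ≤ k → Theta (4 * (k : ℝ) + 12) m n p ≠ 0
  | 0, h => by
    have h1 := qiN_pos k (2 * ((m : ℤ) + n) + 4) (by lia) (by lia)
    have h2 := qiN_pos k ((m : ℤ) + n + 3) (by lia) (by lia)
    have h3 := qiN_pos k ((m : ℤ) + n + 1) (by lia) (by lia)
    have h4 := qiN_pos k 4 (by lia) (by lia)
    have h5 := qiN_pos k 3 (by lia) (by lia)
    unfold Theta
    positivity
  | p + 1, h => by
    unfold Theta
    refine mul_ne_zero (ne_of_lt ?_) (Theta_ne_zero k m n p (by lia))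
    refine add_neg_of_neg_of_nonpos (coeffA_neg k m n (p + 1) (by lia) (by lia) (by lia))
      (Finset.sum_nonpos fun i hi => ?_)
    rw [Finset.mem_Icc] at hi
    refine mul_nonpos_of_nonpos_of_nonneg
      (coeffA_neg k m n i (by lia) (by lia) (by lia)).le (Finset.prod_nonneg fun j hj => ?_)
    rw [Finset.mem_Icc] at hj
    exact coeffB_nonneg k m n j (by lia) (by lia) (by lia)

/-- In `Sp(4)_k` (i.e. at `N = 4k+12`), the theta net of an admissible triple
`(a,b,c)` of total weight at most `k` is nonzero: the numerical content of the
one-dimensionality of `Hom(V_{(a,0)} ⊗ V_{(b,0)} ⊗ V_{(c,0)}, ℂ)`. -/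
theorem theta_ne_zero_admissible (k : ℕ) (a b c : ℕ)
    (hparity : Even (a + b + c))
    (htri1 : c ≤ a + b) (htri2 : a ≤ b + c) (htri3 : b ≤ a + c)
    (hsum : a + b + c ≤ k)
    (m n p : ℕ)
    (hm : m = (a + b - c) / 2) (hn : n = (b + c - a) / 2) (hp : p = (a + c - b) / 2) :
    Theta (4 * (k : ℝ) + 12) m n p ≠ 0 := by
  exact Theta_ne_zero k m n p (by
    obtain ⟨r, hr⟩ := hparity
    lia)
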